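/- Let I be a monomial ideal in a polynomial ring S, and let P be one of the following properties: Cohen-Macaulay, generalized Cohen-Macaulay, unmixed. If I has property P, then every associated radical √(I : u) of I (u a monomial not in I) has property P. -/

import Mathlib

open CategoryTheory CategoryTheory.Limits MvPolynomial

noncomputable section

namespace SkewTab

/-! ### Partitions and skew shapes (0-indexed) -/

/-- `lam` is a partition with exactly `n` positive parts (0-indexed),
extended by `0` beyond index `n - 1`. -/
def IsPartitionFn (n : ℕ) (lam : ℕ → ℕ) : Prop :=
  0 < n ∧ Antitone lam ∧ (∀ i, i < n → 0 < lam i) ∧ ∀ i, n ≤ i → lam i = 0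

/-- `λ/μ` is a skew shape with `n` rows (0-indexed): `λ_i > μ_i ≥ 0` and `μ_n = 0`. -/
def IsSkewShape (n : ℕ) (lam mu : ℕ → ℕ) : Prop :=
  0 < n ∧ Antitone lam ∧ Antitone mu ∧ (∀ i, i < n → mu i < lam i) ∧
    (∀ i, n ≤ i → lam i = 0) ∧ mu (n - 1) = 0

/-- The conjugate partition: `conj lam j = #{i : lam i > j}` (0-indexed). -/
def conj (lam : ℕ → ℕ) (j : ℕ) : ℕ := Nat.card {i | j < lam i}

/-- The set of boxes of the skew diagram `λ/μ` (0-indexed `(row, column)` pairs). -/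
def skewDiagram (lam mu : ℕ → ℕ) : Set (ℕ × ℕ) :=
  {p | mu p.1 ≤ p.2 ∧ p.2 < lam p.1}

/-- The set of boxes of the Ferrers diagram of a partition. -/
def ferrers (nu : ℕ → ℕ) : Set (ℕ × ℕ) := {p | p.2 < nu p.1}

/-- The block of the Ferrers diagram of `nu` containing the box `p`:  blocks are the
rectangular regions cut out by the horizontal lines at the values of the conjugate
partition and the vertical lines at the values of the partition. -/
def blockOf (nu : ℕ → ℕ) (p : ℕ × ℕ) : Set (ℕ × ℕ) :=
  {q | q.2 < nu q.1 ∧ nu q.1 = nu p.1 ∧ conj nu q.2 = conj nu p.2}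

/-- A box `(i,j)` of the diagram of `nu` lies in a *corner block* iff its block has no
block to its right nor below it. -/
def InCornerBlock (nu : ℕ → ℕ) (i j : ℕ) : Prop :=
  j < nu i ∧ conj nu (nu i - 1) = conj nu j ∧ nu (conj nu j - 1) = nu i

/-- A partition is unmixed iff all its corner blocks are square
(height of the block = width of the block). -/
def IsUnmixedPartition (nu : ℕ → ℕ) : Prop :=
  (∃ n, IsPartitionFn n nu) ∧
    ∀ i j, InCornerBlock nu i j →
      conj nu (nu i - 1) - conj nu (nu i) = nu (conj nu j - 1) - nu (conj nu j)

/-- A partition all of whose corner blocks are single boxes (1 × 1):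
the condition defining prime Cohen-Macaulay shapes. -/
def IsCMPartition (nu : ℕ → ℕ) : Prop :=
  (∃ n, IsPartitionFn n nu) ∧
    ∀ i j, InCornerBlock nu i j →
      conj nu (nu i - 1) - conj nu (nu i) = 1 ∧ nu (conj nu j - 1) - nu (conj nu j) = 1

/-- A copy of (the diagram of) a partition `nu` placed in the plane.  If `upper = true`
it is placed rotated by 180° and anchored at the bottom-right position `(row, col)`
(an upper triangular shape, hugging the top-right); if `upper = false` it is placed as is,
translated by `(row, col)` (a lower triangular shape, hugging the bottom-left). -/
structure PlacedShape where
  nu : ℕ → ℕ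
  row : ℕ
  col : ℕ
  upper : Bool

/-- The embedding of the abstract diagram of `B.nu` into the plane. -/
def PlacedShape.emb (B : PlacedShape) : ℕ × ℕ → ℕ × ℕ := fun p =>
  if B.upper then (B.row - p.1, B.col - p.2) else (B.row + p.1, B.col + p.2)

/-- The set of boxes of a placed shape. -/
def PlacedShape.boxes (B : PlacedShape) : Set (ℕ × ℕ) := B.emb '' ferrers B.nu

/-- For an upper triangular placed shape the anchor must leave room for the whole
(rotated) diagram. -/
def PlacedShape.Valid (B : PlacedShape) : Prop :=
  B.upper = true → conj B.nu 0 ≤ B.row + 1 ∧ B.nu 0 ≤ B.col + 1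

/-- The two extremal blocks (top-right and bottom-left corner blocks) of a placed
shape, as subsets of the plane. -/
def PlacedShape.extremalBlocks (B : PlacedShape) : Set (Set (ℕ × ℕ)) :=
  {B.emb '' blockOf B.nu (0, B.nu 0 - 1), B.emb '' blockOf B.nu (conj B.nu 0 - 1, 0)}

/-- `D` decomposes as a union of prime shapes `B 0, …, B (t-1)` (each a placed copy of a
partition satisfying `P`), consecutive shapes being of alternating (upper/lower) type and
intersecting exactly in a common extremal block. -/
def IsPrimeDecomposition (P : (ℕ → ℕ) → Prop) (D : Set (ℕ × ℕ)) (t : ℕ)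
    (B : ℕ → PlacedShape) : Prop :=
  0 < t ∧ (∀ k, k < t → P (B k).nu ∧ (B k).Valid) ∧
    (⋃ k ∈ Set.Iio t, (B k).boxes) = D ∧
    (∀ k, k + 1 < t → (B k).upper ≠ (B (k + 1)).upper) ∧
    ∀ k, k + 1 < t →
      (B k).boxes ∩ (B (k + 1)).boxes ∈ (B k).extremalBlocks ∧
      (B k).boxes ∩ (B (k + 1)).boxes ∈ (B (k + 1)).extremalBlocks

/-- The filling `w` is weakly increasing along both rows and columns on the boxes of `S`. -/
def WeaklyIncreasingOn (w : ℕ → ℕ → ℕ) (S : Set (ℕ × ℕ)) : Prop :=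
  (∀ i j, (i, j) ∈ S → (i, j + 1) ∈ S → w i j ≤ w i (j + 1)) ∧
    ∀ i j, (i, j) ∈ S → (i + 1, j) ∈ S → w i j ≤ w (i + 1) j

/-- The filling `w` is weakly decreasing along both rows and columns on the boxes of `S`. -/
def WeaklyDecreasingOn (w : ℕ → ℕ → ℕ) (S : Set (ℕ × ℕ)) : Prop :=
  (∀ i j, (i, j) ∈ S → (i, j + 1) ∈ S → w i (j + 1) ≤ w i j) ∧
    ∀ i j, (i, j) ∈ S → (i + 1, j) ∈ S → w (i + 1) j ≤ w i j

/-! ### Ideals and graphs attached to skew shapes -/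

/-- The skew Ferrers ideal `I_{λ/μ}` in `k[x_1,…,x_n,y_1,…,y_m]`, `m = λ_1`. -/
def skewIdeal (k : Type) [Field k] (n : ℕ) (lam mu : ℕ → ℕ) :
    Ideal (MvPolynomial (Fin n ⊕ Fin (lam 0)) k) :=
  Ideal.span {q | ∃ (i : Fin n) (j : Fin (lam 0)),
    mu (i : ℕ) ≤ (j : ℕ) ∧ (j : ℕ) < lam (i : ℕ) ∧ q = X (Sum.inl i) * X (Sum.inr j)}

/-- The skew tableau ideal `I(Y)` of the filling `w` of the skew shape `λ/μ`. -/
def tableauIdeal (k : Type) [Field k] (n : ℕ) (lam mu : ℕ → ℕ) (w : ℕ → ℕ → ℕ) :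
    Ideal (MvPolynomial (Fin n ⊕ Fin (lam 0)) k) :=
  Ideal.span {q | ∃ (i : Fin n) (j : Fin (lam 0)),
    mu (i : ℕ) ≤ (j : ℕ) ∧ (j : ℕ) < lam (i : ℕ) ∧
      q = (X (Sum.inl i) * X (Sum.inr j)) ^ w (i : ℕ) (j : ℕ)}

/-- The skew tableau ideal of the skew tableau obtained from `Y` by keeping only the rows
in `Rs` and the columns in `Cs`. -/
def tableauIdealRC (k : Type) [Field k] (n m : ℕ) (lam mu : ℕ → ℕ) (w : ℕ → ℕ → ℕ)
    (Rs : Set (Fin n)) (Cs : Set (Fin m)) : Ideal (MvPolynomial (↥Rs ⊕ ↥Cs) k) :=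
  Ideal.span {q | ∃ (i : ↥Rs) (j : ↥Cs),
    mu (i.1 : ℕ) ≤ (j.1 : ℕ) ∧ (j.1 : ℕ) < lam (i.1 : ℕ) ∧
      q = (X (Sum.inl i) * X (Sum.inr j)) ^ w (i.1 : ℕ) (j.1 : ℕ)}

/-- The skew Ferrers graph `G_{λ/μ}`, a bipartite graph on `{x_1,…,x_n} ⊔ {y_1,…,y_m}`. -/
def skewGraph (n : ℕ) (lam mu : ℕ → ℕ) : SimpleGraph (Fin n ⊕ Fin (lam 0)) :=
  SimpleGraph.fromRel fun a b => ∃ (i : Fin n) (j : Fin (lam 0)),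
    mu (i : ℕ) ≤ (j : ℕ) ∧ (j : ℕ) < lam (i : ℕ) ∧ a = Sum.inl i ∧ b = Sum.inr j

/-- The edge ideal of a simple graph. -/
def edgeIdeal (k : Type) [Field k] {V : Type} (G : SimpleGraph V) :
    Ideal (MvPolynomial V k) :=
  Ideal.span {q | ∃ u v, G.Adj u v ∧ q = X u * X v}

/-- The edge ideal of an edge-weighted simple graph. -/
def edgeIdealW (k : Type) [Field k] {V : Type} (G : SimpleGraph V) (w : V → V → ℕ) :
    Ideal (MvPolynomial V k) :=
  Ideal.span {q | ∃ u v, G.Adj u v ∧ q = (X u * X v) ^ w u v}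

/-! ### Homological notions -/

/-- The homogeneous maximal ideal of a polynomial ring. -/
def maxIdeal (k : Type) [Field k] (σ : Type) : Ideal (MvPolynomial σ k) :=
  Ideal.span (Set.range (X : σ → MvPolynomial σ k))

/-- The `i`-th local cohomology of the `R`-module `M` supported at the ideal `J`. -/
def localCoh {R : Type} [CommRing R] (J : Ideal R) (i : ℕ) (M : Type) [AddCommGroup M]
    [Module R M] : ModuleCat R :=
  (localCohomology J i).obj (ModuleCat.of R M)

/-- The Krull dimension of a module, `dim (R / ann M)`. -/
def moduleDim (R : Type) [CommRing R] (M : Type) [AddCommGroup M] [Module R M] :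
    WithBot ℕ∞ :=
  ringKrullDim (R ⧸ Module.annihilator R M)

/-- A module `M` is Cohen-Macaulay (w.r.t. the maximal ideal `J`) if
`H^i_J(M) = 0` for all `i < dim M`. -/
def IsCMModule {R : Type} [CommRing R] (J : Ideal R) (M : Type) [AddCommGroup M]
    [Module R M] : Prop :=
  ∀ i : ℕ, (i : WithBot ℕ∞) < moduleDim R M → IsZero (localCoh J i M)

/-- An ideal `I` is Cohen-Macaulay if `H^i_J(R/I) = 0` for all `i < dim R/I`
(`J` the maximal ideal). -/
def IsCMIdeal {R : Type} [CommRing R] (J I : Ideal R) : Prop :=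
  ∀ i : ℕ, (i : WithBot ℕ∞) < ringKrullDim (R ⧸ I) → IsZero (localCoh J i (R ⧸ I))

/-- An ideal `I` is generalized Cohen-Macaulay if `H^i_J(R/I)` has finite length for
all `i < dim R/I`. -/
def IsGCMIdeal {R : Type} [CommRing R] (J I : Ideal R) : Prop :=
  ∀ i : ℕ, (i : WithBot ℕ∞) < ringKrullDim (R ⧸ I) → IsFiniteLength R (localCoh J i (R ⧸ I))

/-- The canonical map `Ext^i(R/J, M) → H^i_J(M)`, i.e. the structure map of the colimit
defining local cohomology, at the first power of `J`. -/
def extToLocalCoh {R : Type} [CommRing R] (J : Ideal R) (i : ℕ) (M : ModuleCat R) :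
    ((localCohomology.diagram (localCohomology.idealPowersDiagram J) i).obj
        (Opposite.op (Opposite.op (1 : ℕ)))).obj M ⟶ (localCohomology J i).obj M :=
  have := localCohomology.hasColimitDiagram (localCohomology.idealPowersDiagram J) i
  (colimit.ι (localCohomology.diagram (localCohomology.idealPowersDiagram J) i)
    (Opposite.op (Opposite.op (1 : ℕ)))).app M

/-- An ideal `I` is Buchsbaum if the canonical map `Ext^i(R/J, R/I) → H^i_J(R/I)` is
surjective for all `i < dim R/I` (`J` the maximal ideal). -/
def IsBuchsbaumIdeal {R : Type} [CommRing R] (J I : Ideal R) : Prop :=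
  ∀ i : ℕ, (i : WithBot ℕ∞) < ringKrullDim (R ⧸ I) →
    Function.Surjective (extToLocalCoh J i (ModuleCat.of R (R ⧸ I)))

/-- An ideal `I` is unmixed if `dim R/P = dim R/I` for all associated primes `P` of `R/I`. -/
def IsUnmixedIdeal {R : Type} [CommRing R] (I : Ideal R) : Prop :=
  ∀ P ∈ associatedPrimes R (R ⧸ I), ringKrullDim (R ⧸ P) = ringKrullDim (R ⧸ I)

/-- A submodule of `S/J` (`S` a polynomial ring) is graded if it is the image of a
homogeneous ideal of `S`. -/
def IsGradedSubmodule (k σ : Type) [Field k] (J : Ideal (MvPolynomial σ k))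
    (N : Submodule (MvPolynomial σ k) (MvPolynomial σ k ⧸ J)) : Prop :=
  letI := MvPolynomial.gradedAlgebra (σ := σ) (R := k)
  ∃ K : Ideal (MvPolynomial σ k), Ideal.IsHomogeneous (homogeneousSubmodule σ k) K ∧
    ∀ x, x ∈ N ↔ x ∈ K.map (Ideal.Quotient.mk J)

/-- A (homogeneous) ideal `J` of a polynomial ring `S` is sequentially Cohen-Macaulay if
`S/J` admits a filtration `0 = M_0 ⊂ M_1 ⊂ ⋯ ⊂ M_r = S/J` by graded submodules such that
every quotient `M_{i+1}/M_i` is Cohen-Macaulay and the dimensions of the quotients are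
strictly increasing. -/
def IsSCMIdeal (k σ : Type) [Field k] (J : Ideal (MvPolynomial σ k)) : Prop :=
  ∃ (r : ℕ) (M : ℕ → Submodule (MvPolynomial σ k) (MvPolynomial σ k ⧸ J)),
    M 0 = ⊥ ∧ M r = ⊤ ∧ (∀ i, i < r → M i < M (i + 1)) ∧
    (∀ i, i ≤ r → IsGradedSubmodule k σ J (M i)) ∧
    (∀ i, i < r → IsCMModule (maxIdeal k σ)
      (↥(M (i + 1)) ⧸ Submodule.comap (M (i + 1)).subtype (M i))) ∧
    ∀ i, i + 2 ≤ r →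
      moduleDim (MvPolynomial σ k)
          (↥(M (i + 1)) ⧸ Submodule.comap (M (i + 1)).subtype (M i)) <
        moduleDim (MvPolynomial σ k)
          (↥(M (i + 2)) ⧸ Submodule.comap (M (i + 2)).subtype (M (i + 1)))

/-- A graph is sequentially Cohen-Macaulay if its edge ideal is. -/
def IsSCMGraph (k : Type) [Field k] {V : Type} (G : SimpleGraph V) : Prop :=
  IsSCMIdeal k V (edgeIdeal k G)

/-! ### Monomial ideals -/

/-- A monomial of a polynomial ring. -/
def IsMonomial {k σ : Type} [Field k] (u : MvPolynomial σ k) : Prop :=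
  ∃ d : σ →₀ ℕ, u = monomial d 1

/-- A monomial ideal of a polynomial ring. -/
def IsMonomialIdeal {k σ : Type} [Field k] (I : Ideal (MvPolynomial σ k)) : Prop :=
  ∃ T : Set (σ →₀ ℕ), I = Ideal.span ((fun d => (monomial d (1 : k) : MvPolynomial σ k)) '' T)

/-! ### Saturated partitions -/

/-- A partition is saturated if it is either strictly decreasing, or
`{λ_i, λ_i - 1, …, 1} ⊆ {λ_1, …, λ_n}` where `i` is the smallest index with
`λ_i = λ_{i+1}` (0-indexed here). -/
def IsSaturated (n : ℕ) (lam : ℕ → ℕ) : Prop :=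
  StrictAntiOn lam (Set.Iio n) ∨
    ∃ i, i + 1 < n ∧ lam i = lam (i + 1) ∧ (∀ j, j < i → lam j ≠ lam (j + 1)) ∧
      ∀ v, 0 < v → v ≤ lam i → ∃ a, a < n ∧ lam a = v

/-! ### Vertex decomposability -/

/-- A set `T` of vertices is independent in `G`. -/
def IsIndepSet {V : Type} (G : SimpleGraph V) (T : Finset V) : Prop :=
  ∀ u ∈ T, ∀ v ∈ T, ¬G.Adj u v

open Classical in
/-- The induced subgraph of `G` on a finite vertex set `A` is vertex decomposable:
either it has no edges, or it has a shredding vertex `v`, i.e. a vertex such that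
`G \ v` and `G \ N[v]` are vertex decomposable and no independent set of `G \ N[v]`
is a maximal independent set of `G \ v`. -/
def IsVertexDecomposable {V : Type} (G : SimpleGraph V) : Finset V → Prop := fun A =>
  (∀ u ∈ A, ∀ v ∈ A, ¬G.Adj u v) ∨
    ∃ v, ∃ _ : v ∈ A,
      IsVertexDecomposable G (A.erase v) ∧
      IsVertexDecomposable G (A.filter fun u => u ≠ v ∧ ¬G.Adj v u) ∧
      ∀ T ⊆ A.filter fun u => u ≠ v ∧ ¬G.Adj v u, IsIndepSet G T →
        ¬(T ⊆ A.erase v ∧ IsIndepSet G T ∧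
            ∀ u ∈ A.erase v, u ∉ T → ∃ t ∈ T, G.Adj u t)
termination_by A => A.card
decreasing_by
  · exact Finset.card_erase_lt_of_mem ‹_›
  · exact Finset.card_lt_card (Finset.filter_ssubset.mpr ⟨v, ‹_›, by simp⟩)


section LeftDerived

variable {C D E : Type*} [Category* C] [Category* D] [Category* E]
  [Abelian C] [Abelian D] [Abelian E]

lemma comm_sq_paste {C : Type*} [Category* C] {A₁ A₂ A₃ B₁ B₂ B₃ : C}
    {f₁ : A₁ ⟶ B₁} {f₂ : A₂ ⟶ B₂} {f₃ : A₃ ⟶ B₃}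
    {a : A₁ ⟶ A₂} {a' : A₂ ⟶ A₃} {b : B₁ ⟶ B₂} {b' : B₂ ⟶ B₃}
    (h : f₁ ≫ b = a ≫ f₂) (h' : f₂ ≫ b' = a' ≫ f₃) :
    f₁ ≫ b ≫ b' = (a ≫ a') ≫ f₃ := by
  rw [reassoc_of% h, h', Category.assoc]

/-- An exact functor `G` preserving projective objects can be moved inside a left derived
functor. -/
def leftDerivedPrecompIso [HasProjectiveResolutions C] [HasProjectiveResolutions D]
    (G : C ⥤ D) [G.Additive] [G.PreservesProjectiveObjects]
    [G.PreservesHomology] (F : D ⥤ E) [F.Additive] (n : ℕ) :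
    (G ⋙ F).leftDerived n ≅ G ⋙ F.leftDerived n :=
  NatIso.ofComponents
    (fun X => (projectiveResolution X).isoLeftDerivedObj (G ⋙ F) n ≪≫
      ((G.mapProjectiveResolution (projectiveResolution X)).isoLeftDerivedObj F n).symm)
    (fun {X Y} f => by
      have h : (ProjectiveResolution.lift f (projectiveResolution X)
          (projectiveResolution Y)).f 0 ≫ (projectiveResolution Y).π.f 0 =
          (projectiveResolution X).π.f 0 ≫ f :=
        ProjectiveResolution.lift_commutes_zero _ _ _
      have h' := congrArg G.map h
      replace h' := (G.map_comp _ _).symm.trans (h'.trans (G.map_comp _ _))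
      exact comm_sq_paste (ProjectiveResolution.isoLeftDerivedObj_hom_naturality f
          (projectiveResolution X) (projectiveResolution Y) _ h (G ⋙ F) n)
        (ProjectiveResolution.isoLeftDerivedObj_inv_naturality (G.map f)
          (G.mapProjectiveResolution (projectiveResolution X))
          (G.mapProjectiveResolution (projectiveResolution Y))
          ((G.mapHomologicalComplex _).map (ProjectiveResolution.lift f (projectiveResolution X)
            (projectiveResolution Y))) (by
            simp
            exact comm_sq_paste h' ((Category.comp_id _).trans (Category.id_comp _).symm)) F n).symm)

/-- An exact functor `H` commutes with forming left derived functors. -/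
def leftDerivedPostcompIso [HasProjectiveResolutions C] (F : C ⥤ D) [F.Additive] (H : D ⥤ E)
    [H.Additive] [H.PreservesHomology] (n : ℕ) :
    (F ⋙ H).leftDerived n ≅ F.leftDerived n ⋙ H :=
  NatIso.ofComponents
    (fun X => (projectiveResolution X).isoLeftDerivedObj (F ⋙ H) n ≪≫
      ((((F.mapHomologicalComplex _).obj (projectiveResolution X).complex).sc n).mapHomologyIso H)
        ≪≫ H.mapIso ((projectiveResolution X).isoLeftDerivedObj F n).symm)
    (fun {X Y} f => by
      have h : (ProjectiveResolution.lift f (projectiveResolution X)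
          (projectiveResolution Y)).f 0 ≫ (projectiveResolution Y).π.f 0 =
          (projectiveResolution X).π.f 0 ≫ f :=
        ProjectiveResolution.lift_commutes_zero _ _ _
      have h2 := congrArg H.map (ProjectiveResolution.isoLeftDerivedObj_inv_naturality f
        (projectiveResolution X) (projectiveResolution Y) _ h F n)
      rw [H.map_comp, H.map_comp] at h2
      exact comm_sq_paste (ProjectiveResolution.isoLeftDerivedObj_hom_naturality f
          (projectiveResolution X) (projectiveResolution Y) _ h (F ⋙ H) n)
        (comm_sq_paste (ShortComplex.mapHomologyIso_hom_naturality
          ((HomologicalComplex.shortComplexFunctor D _ n).map ((F.mapHomologicalComplex _).map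
            (ProjectiveResolution.lift f (projectiveResolution X) (projectiveResolution Y)))) H)
          h2.symm))

end LeftDerived

section BaseChange

variable {R R' : Type} [CommRing R] [CommRing R'] (f : R →+* R')

/-- The adjunction between extension and restriction of scalars, as a linear equivalence of
`Hom` modules. -/
def extendRestrictHomEquiv (X : ModuleCat.{0} R) (M : ModuleCat.{0} R') :
    (ModuleCat.restrictScalars f).obj
        (ModuleCat.of R' ((ModuleCat.extendScalars.{0, 0, 0} f).obj X ⟶ M)) ≃ₗ[R]
      ModuleCat.of R (X ⟶ (ModuleCat.restrictScalars f).obj M) where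
  toFun := (ModuleCat.extendRestrictScalarsAdj f).homEquiv X M
  invFun := ((ModuleCat.extendRestrictScalarsAdj f).homEquiv X M).symm
  left_inv := Equiv.left_inv _
  right_inv := Equiv.right_inv _
  map_add' a b := by
    ext x
    rfl
  map_smul' r a := by
    ext x
    rfl

/-- Extension of scalars followed by `Hom(-, M)` is `Hom(-, M)` over the base ring. -/
def extendYonedaIso (M : ModuleCat.{0} R') :
    ((linearYoneda R (ModuleCat.{0} R)).obj ((ModuleCat.restrictScalars f).obj M)).rightOp ≅
    ModuleCat.extendScalars.{0, 0, 0} f ⋙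
      (((linearYoneda R' (ModuleCat.{0} R')).obj M).rightOp ⋙ (ModuleCat.restrictScalars f).op) :=
  NatIso.ofComponents (fun X => (extendRestrictHomEquiv f X M).toModuleIso.op)
    (fun {X Y} g => Quiver.Hom.unop_inj (by
      ext x
      exact ((ModuleCat.extendRestrictScalarsAdj f).homEquiv_naturality_left g x).symm))

instance : (ModuleCat.extendScalars.{0, 0, 0} f).PreservesProjectiveObjects :=
  Functor.preservesProjectiveObjects_of_adjunction_of_preservesEpimorphisms
    (ModuleCat.extendRestrictScalarsAdj f)

instance : (ModuleCat.extendScalars.{0, 0, 0} f).Additive :=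
  (ModuleCat.extendRestrictScalarsAdj f).left_adjoint_additive

lemma extendScalars_preservesHomology (hf : f.Flat) :
    (ModuleCat.extendScalars.{0, 0, 0} f).PreservesHomology := by
  have key : ∀ S : ShortComplex (ModuleCat.{0} R), S.Exact →
      (S.map (ModuleCat.extendScalars.{0, 0, 0} f)).Exact := by
    intro S hS
    rw [ShortComplex.ShortExact.moduleCat_exact_iff_function_exact] at hS ⊢
    let _ := f.toAlgebra
    have : Module.Flat R R' := hf
    exact Module.Flat.lTensor_exact (M := R') hS
  have := ((Functor.exact_tfae (ModuleCat.extendScalars.{0, 0, 0} f)).out 1 2).mp key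
  exact this

end BaseChange

/-- Naturally isomorphic functors have isomorphic left derived functors. -/
def leftDerivedIsoOfIso {C D : Type*} [Category* C] [Category* D] [Abelian C] [Abelian D]
    [HasProjectiveResolutions C] {F G : C ⥤ D} [F.Additive] [G.Additive] (e : F ≅ G) (n : ℕ) :
    F.leftDerived n ≅ G.leftDerived n where
  hom := NatTrans.leftDerived e.hom n
  inv := NatTrans.leftDerived e.inv n
  hom_inv_id := by rw [← NatTrans.leftDerived_comp, e.hom_inv_id, NatTrans.leftDerived_id]
  inv_hom_id := by rw [← NatTrans.leftDerived_comp, e.inv_hom_id, NatTrans.leftDerived_id]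

section LocalCohomologyBaseChange
variable {R R' : Type} [CommRing R] [CommRing R'] (f : R →+* R')

/-- Flat base change for the left derived functors defining `Ext`. -/
def extBaseChangeRightOp (hf : f.Flat) (M : ModuleCat.{0} R') (n : ℕ) :
    ((linearYoneda R (ModuleCat.{0} R)).obj
        ((ModuleCat.restrictScalars f).obj M)).rightOp.leftDerived n ≅
      ModuleCat.extendScalars.{0, 0, 0} f ⋙
        (((linearYoneda R' (ModuleCat.{0} R')).obj M).rightOp.leftDerived n ⋙
          (ModuleCat.restrictScalars f).op) :=
  haveI := extendScalars_preservesHomology f hf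
  leftDerivedIsoOfIso (extendYonedaIso f M) n ≪≫
    leftDerivedPrecompIso (ModuleCat.extendScalars.{0, 0, 0} f)
      (((linearYoneda R' (ModuleCat.{0} R')).obj M).rightOp ⋙ (ModuleCat.restrictScalars f).op) n ≪≫
    Functor.isoWhiskerLeft _ (leftDerivedPostcompIso
      ((linearYoneda R' (ModuleCat.{0} R')).obj M).rightOp (ModuleCat.restrictScalars f).op n)

/-- Flat base change for `Ext`. -/
def extBaseChange (hf : f.Flat) (M : ModuleCat.{0} R') (n : ℕ) :
    (Ext R (ModuleCat.{0} R) n).flip.obj ((ModuleCat.restrictScalars f).obj M) ≅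
      (ModuleCat.extendScalars.{0, 0, 0} f).op ⋙
        ((Ext R' (ModuleCat.{0} R') n).flip.obj M ⋙ ModuleCat.restrictScalars f) :=
  NatIso.ofComponents (fun X => ((extBaseChangeRightOp f hf M n).app X.unop).symm.unop)
    (fun {X Y} g => by 
      have := (extBaseChangeRightOp f hf M n).inv.naturality g.unop
      exact congrArg Quiver.Hom.unop this.symm)

/-- Extension of scalars of a cyclic module `R ⧸ I` is `R' ⧸ I R'`. -/
def extendScalarsQuotientEquiv (I : Ideal R) :
    (R' ⧸ I.map f) ≃ₗ[R'] (ModuleCat.extendScalars.{0, 0, 0} f).obj (ModuleCat.of R (R ⧸ I)) :=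
  letI := f.toAlgebra
  (Algebra.TensorProduct.quotIdealMapEquivTensorQuot R' I).toLinearEquiv

/-- Extension of scalars sends the diagram of quotients by powers of `J` to the diagram of
quotients by powers of the extended ideal. -/
def ringModIdealsExtendScalarsIso (J : Ideal R) :
    localCohomology.ringModIdeals (localCohomology.idealPowersDiagram (J.map f)) ≅
      localCohomology.ringModIdeals (localCohomology.idealPowersDiagram J) ⋙
        ModuleCat.extendScalars.{0, 0, 0} f :=
  NatIso.ofComponents
    (fun t => ((Submodule.quotEquivOfEq _ _ (Ideal.map_pow f J t.unop).symm).trans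
      (extendScalarsQuotientEquiv f (J ^ t.unop))).toModuleIso)
    (fun {X Y} g => by
      ext x
      obtain ⟨x, rfl⟩ := Submodule.Quotient.mk_surjective _ x
      rfl)

/-- Flat base change for the diagrams computing local cohomology. -/
def localCohomologyDiagramBaseChange (hf : f.Flat) (J : Ideal R) (M : ModuleCat.{0} R') (n : ℕ) :
    localCohomology.diagram (localCohomology.idealPowersDiagram J) n ⋙
        (evaluation _ _).obj ((ModuleCat.restrictScalars f).obj M) ≅
      (localCohomology.diagram (localCohomology.idealPowersDiagram (J.map f)) n ⋙
        (evaluation _ _).obj M) ⋙ ModuleCat.restrictScalars f :=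
  Functor.isoWhiskerLeft (localCohomology.ringModIdeals (localCohomology.idealPowersDiagram J)).op
      (extBaseChange f hf M n) ≪≫
    Functor.isoWhiskerRight (NatIso.op (ringModIdealsExtendScalarsIso f J))
      ((Ext R' (ModuleCat.{0} R') n).flip.obj M ⋙ ModuleCat.restrictScalars f)

/-- Flat base change for local cohomology of a module over the target ring. -/
def localCohomologyBaseChange (hf : f.Flat) (J : Ideal R) (M : ModuleCat.{0} R') (n : ℕ) :
    (localCohomology J n).obj ((ModuleCat.restrictScalars f).obj M) ≅
      (ModuleCat.restrictScalars f).obj ((localCohomology (J.map f) n).obj M) :=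
  colimitObjIsoColimitCompEvaluation
      (localCohomology.diagram (localCohomology.idealPowersDiagram J) n) _ ≪≫
    HasColimit.isoOfNatIso (localCohomologyDiagramBaseChange f hf J M n) ≪≫
    (preservesColimitIso (ModuleCat.restrictScalars f) _).symm ≪≫
    (ModuleCat.restrictScalars f).mapIso (colimitObjIsoColimitCompEvaluation
      (localCohomology.diagram (localCohomology.idealPowersDiagram (J.map f)) n) M).symm

end LocalCohomologyBaseChange

section Expand

variable {k σ : Type} [Field k] (N : ℕ)

/-- The remainder of an exponent vector modulo `N`, coordinatewise. -/
def expRem (c : σ →₀ ℕ) : σ →₀ ℕ := c.mapRange (· % N) (Nat.zero_mod N)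

/-- The quotient of an exponent vector by `N`, coordinatewise. -/
def expDiv (c : σ →₀ ℕ) : σ →₀ ℕ := c.mapRange (· / N) (Nat.zero_div N)

lemma expRem_add_smul (r c : σ →₀ ℕ) : expRem N (r + N • c) = expRem N r := by
  ext i; simp [expRem]

lemma expDiv_add_smul (hN : 0 < N) (r c : σ →₀ ℕ) :
    expDiv N (r + N • c) = expDiv N r + c := by
  ext i; simp [expDiv, Nat.add_mul_div_left _ _ hN]

lemma expRem_add_smul_expDiv (c : σ →₀ ℕ) : expRem N c + N • expDiv N c = c := by
  ext i; simp [expDiv, expRem, Nat.mod_add_div]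

lemma expDiv_eq_zero (hN : 0 < N) {r : σ →₀ ℕ} (hr : expRem N r = r) : expDiv N r = 0 := by
  have h := expRem_add_smul_expDiv N r
  rw [hr] at h
  have h := add_eq_left.mp h
  exact (smul_eq_zero.mp h).resolve_left hN.ne'

lemma expRem_expRem (c : σ →₀ ℕ) : expRem N (expRem N c) = expRem N c := by
  ext i; simp [expRem]

open Classical in
/-- The coordinate of a polynomial at the monomial `r` when the polynomial ring is regarded as a
module over itself along `MvPolynomial.expand N`. -/
def expandCoord (r : σ →₀ ℕ) : MvPolynomial σ k →ₗ[k] MvPolynomial σ k :=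
  (basisMonomials σ k).constr k
    (fun c => if expRem N c = r then monomial (expDiv N c) 1 else 0)

open Classical in
lemma expandCoord_monomial (r c : σ →₀ ℕ) (t : k) :
    expandCoord N r (monomial c t) =
      if expRem N c = r then monomial (expDiv N c) t else 0 := by
  have h : (monomial c t : MvPolynomial σ k) = t • basisMonomials σ k c := by
    simp [coe_basisMonomials, smul_monomial]
  rw [h, map_smul, expandCoord, Module.Basis.constr_basis]
  split_ifs
  · simp [smul_monomial]
  · simp

lemma expandCoord_expand_mul (hN : 0 < N) (r : σ →₀ ℕ) (q p : MvPolynomial σ k) :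
    expandCoord N r (expand N q * p) = q * expandCoord N r p := by
  induction q using MvPolynomial.induction_on' with
  | add a b ha hb => rw [map_add, add_mul, map_add, ha, hb, add_mul]
  | monomial c t =>
    induction p using MvPolynomial.induction_on' with
    | add a b ha hb => rw [mul_add, map_add, ha, hb, map_add, mul_add]
    | monomial d s =>
      rw [expand_monomial, monomial_mul, expandCoord_monomial, expandCoord_monomial, add_comm,
        expRem_add_smul, expDiv_add_smul N hN]
      split_ifs
      · rw [monomial_mul, add_comm]
      · rw [mul_zero]

lemma expandCoord_expand_mul_monomial_self (hN : 0 < N) {r : σ →₀ ℕ} (hr : expRem N r = r)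
    (q : MvPolynomial σ k) : expandCoord N r (expand N q * monomial r 1) = q := by
  rw [expandCoord_expand_mul N hN, expandCoord_monomial, if_pos hr, expDiv_eq_zero N hN hr]
  exact mul_one q

lemma expandCoord_expand_mul_monomial_of_ne (hN : 0 < N) {r s : σ →₀ ℕ} (hs : expRem N s = s)
    (hrs : s ≠ r) (q : MvPolynomial σ k) :
    expandCoord N r (expand N q * monomial s 1) = 0 := by
  rw [expandCoord_expand_mul N hN, expandCoord_monomial, if_neg (by rwa [hs]), mul_zero]

instance [Finite σ] [NeZero N] : Finite (Set.range (expRem N : (σ →₀ ℕ) → (σ →₀ ℕ))) := by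
  cases nonempty_fintype σ
  classical
  refine ((Set.finite_Icc 0 (Finsupp.equivFunOnFinite.symm fun _ : σ => N)).subset ?_).to_subtype
  rintro _ ⟨c, rfl⟩
  refine ⟨zero_le, fun i => ?_⟩
  exact (Nat.mod_lt _ (NeZero.pos N)).le

end Expand

section ExpandFlat
variable (k σ : Type) [Field k] [Finite σ] (N : ℕ) [NeZero N]

lemma flat_finite_of_coord {A B ι : Type} [CommRing A] [CommRing B] [Finite ι] (f : A →+* B)
    (v : ι → B) (c : ι → B →+ A) (hc : ∀ r q, c r (f q * v r) = q)
    (hc' : ∀ r s q, s ≠ r → c r (f q * v s) = 0)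
    (hv : ∀ p, p ∈ AddSubmonoid.closure {p | ∃ q r, p = f q * v r}) : f.Flat ∧ f.Finite := by
  let _ := f.toAlgebra
  cases nonempty_fintype ι
  have hli : LinearIndependent A v := by
    rw [Fintype.linearIndependent_iff]
    intro g hg r
    have h := congrArg (c r) hg
    rw [map_sum, Finset.sum_eq_single r, map_zero, Algebra.smul_def] at h
    · exact (hc r (g r)).symm.trans h
    · intro s _ hsr
      rw [Algebra.smul_def]
      exact hc' r s (g s) hsr
    · exact fun h => absurd (Finset.mem_univ r) h
  have hspan : ⊤ ≤ Submodule.span A (Set.range v) := by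
    intro p _
    refine (AddSubmonoid.closure_le (S := (Submodule.span A (Set.range v)).toAddSubmonoid)).mpr
      ?_ (hv p)
    rintro _ ⟨q, r, rfl⟩
    exact Submodule.smul_mem _ q (Submodule.subset_span ⟨r, rfl⟩)
  let b := Module.Basis.mk hli hspan
  have := Module.Free.of_basis b
  exact ⟨inferInstanceAs (Module.Flat A B), Module.Finite.of_basis b⟩

/-- The polynomial ring is finite and flat over itself along `MvPolynomial.expand N`. -/
lemma expand_flat_finite :
    (expand N : MvPolynomial σ k →ₐ[k] MvPolynomial σ k).toRingHom.Flat ∧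
      (expand N : MvPolynomial σ k →ₐ[k] MvPolynomial σ k).toRingHom.Finite := by
  have hN : 0 < N := NeZero.pos N
  have hr (r : Set.range (expRem N : (σ →₀ ℕ) → (σ →₀ ℕ))) : expRem N r.1 = r.1 := by
    obtain ⟨_, c, rfl⟩ := r
    exact expRem_expRem N c
  refine flat_finite_of_coord _ (fun r : Set.range (expRem N) => monomial r.1 1)
    (fun r => (expandCoord N r.1).toAddMonoidHom)
    (fun r q => expandCoord_expand_mul_monomial_self N hN (hr r) q)
    (fun r s q hsr => expandCoord_expand_mul_monomial_of_ne N hN (hr s)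
        (fun h => hsr (Subtype.ext h)) q) (fun p => ?_)
  induction p using MvPolynomial.induction_on' with
  | add a b ha hb => exact add_mem ha hb
  | monomial c t =>
    refine AddSubmonoid.subset_closure ⟨monomial (expDiv N c) t, ⟨expRem N c, c, rfl⟩, ?_⟩
    change _ = expand N _ * _
    rw [expand_monomial, monomial_mul, mul_one, add_comm, expRem_add_smul_expDiv]

lemma radical_map_expand_maxIdeal (k σ : Type) [Field k] (N : ℕ) [NeZero N] :
    ((Ideal.span (Set.range (X : σ → MvPolynomial σ k))).map
      (expand N : MvPolynomial σ k →ₐ[k] MvPolynomial σ k).toRingHom).radical =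
    (Ideal.span (Set.range (X : σ → MvPolynomial σ k))).radical := by
  refine le_antisymm (Ideal.radical_mono (Ideal.map_le_iff_le_comap.mpr (Ideal.span_le.mpr ?_)))
    (Ideal.radical_le_radical_iff.mpr (Ideal.span_le.mpr ?_))
  · rintro _ ⟨i, rfl⟩
    refine Ideal.mem_comap.mpr ?_
    change expand N (X i) ∈ Ideal.span (Set.range (X : σ → MvPolynomial σ k))
    rw [expand_X]
    exact Ideal.pow_mem_of_mem _ (Ideal.subset_span (Set.mem_range_self i)) _ (NeZero.pos N)
  · rintro _ ⟨i, rfl⟩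
    refine ⟨N, ?_⟩
    rw [← expand_X]
    exact Ideal.mem_map_of_mem (expand N : MvPolynomial σ k →ₐ[k] MvPolynomial σ k).toRingHom
      (Ideal.subset_span ⟨i, rfl⟩)
end ExpandFlat

section FiniteLength

lemma isNoetherian_isArtinian_of_finite_algebra {R R' : Type} [CommRing R] [CommRing R']
    [Algebra R R'] [IsNoetherianRing R] [Module.Finite R R'] {L : Type} [AddCommGroup L]
    [Module R' L] (h : IsFiniteLength R' L) :
    ∀ [Module R L] [IsScalarTower R R' L], IsNoetherian R L ∧ IsArtinian R L := by
  induction h with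
  | of_subsingleton =>
    intros
    exact ⟨inferInstance, inferInstance⟩
  | @of_simple_quotient L _ _ P hS hP ih =>
    intro _ _
    have hP' : IsNoetherian R P ∧ IsArtinian R P := ih
    have : IsNoetherian R (L ⧸ P) ∧ IsArtinian R (L ⧸ P) := by
      obtain ⟨n, hn, ⟨e⟩⟩ := isSimpleModule_iff_quot_maximal.mp hS
      have : (n.comap (algebraMap R R')).IsMaximal :=
        Ideal.isMaximal_comap_of_isIntegral_of_isMaximal n
      let := Ideal.Quotient.field (n.comap (algebraMap R R'))
      have : Module.Finite (R ⧸ n.comap (algebraMap R R')) (R' ⧸ n) :=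
        Module.Finite.of_restrictScalars_finite R _ _
      have : IsArtinian R (R' ⧸ n) :=
        isArtinian_of_surjective_algebraMap (R := R ⧸ n.comap (algebraMap R R'))
          Ideal.Quotient.mk_surjective
      have : IsNoetherian R (R' ⧸ n) := isNoetherian_of_isNoetherianRing_of_finite _ _
      let e' := e.symm.restrictScalars R
      exact ⟨isNoetherian_of_linearEquiv e', isArtinian_of_linearEquiv e'⟩
    exact ⟨(isNoetherian_iff_submodule_quotient (P.restrictScalars R)).mpr ⟨hP'.1, this.1⟩,
      (isArtinian_iff_submodule_quotient (P.restrictScalars R)).mpr ⟨hP'.2, this.2⟩⟩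

lemma isFiniteLength_restrictScalars {R R' : Type} [CommRing R] [CommRing R']
    [IsNoetherianRing R] {f : R →+* R'} (hf : f.Finite) (M : ModuleCat.{0} R')
    (h : IsFiniteLength R' M) : IsFiniteLength R ((ModuleCat.restrictScalars f).obj M) := by
  let _ := f.toAlgebra
  have : Module.Finite R R' := hf
  let inst : Module R' ((ModuleCat.restrictScalars f).obj M) := inferInstanceAs (Module R' M)
  have : IsScalarTower R R' ((ModuleCat.restrictScalars f).obj M) :=
    ⟨fun r s m => mul_smul (β := M) (f r) s m⟩
  have h' : IsFiniteLength R' ((ModuleCat.restrictScalars f).obj M) := h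
  exact isFiniteLength_iff_isNoetherian_isArtinian.mpr
    (isNoetherian_isArtinian_of_finite_algebra h')

end FiniteLength

section Retract

variable {R R' : Type} [CommRing R] [CommRing R'] (f : R →+* R')
  [IsNoetherianRing R'] {J : Ideal R} {J' : Ideal R'}
  {M : ModuleCat.{0} R} {M' : ModuleCat.{0} R'}

/-- If `M` is a retract of the restriction of scalars of `M'` along a flat ring homomorphism, then
the local cohomology of `M` is a retract of that of `M'`. -/
def localCohomologyRetract (hf : f.Flat) (hJ : (J.map f).radical = J'.radical)
    (r : Retract M ((ModuleCat.restrictScalars f).obj M')) (n : ℕ) :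
    Retract ((localCohomology J n).obj M)
      ((ModuleCat.restrictScalars f).obj ((localCohomology J' n).obj M')) :=
  (r.map (localCohomology J n)).trans (Retract.ofIso (localCohomologyBaseChange f hf J M' n ≪≫
    (ModuleCat.restrictScalars f).mapIso ((localCohomology.isoOfSameRadical hJ n).app M')))

lemma isZero_localCohomology_of_retract (hf : f.Flat) (hJ : (J.map f).radical = J'.radical)
    (r : Retract M ((ModuleCat.restrictScalars f).obj M')) (n : ℕ)
    (h : IsZero ((localCohomology J' n).obj M')) :
    IsZero ((localCohomology J n).obj M) :=
  IsZero.of_mono (localCohomologyRetract f hf hJ r n).i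
    ((ModuleCat.restrictScalars f).map_isZero h)

lemma isFiniteLength_localCohomology_of_retract [IsNoetherianRing R]
    (hf : f.Flat) (hJ : (J.map f).radical = J'.radical)
    (r : Retract M ((ModuleCat.restrictScalars f).obj M')) (n : ℕ) (hf' : f.Finite)
    (h : IsFiniteLength R' ((localCohomology J' n).obj M')) :
    IsFiniteLength R ((localCohomology J n).obj M) :=
  (isFiniteLength_restrictScalars hf' _ h).of_injective
    (f := (localCohomologyRetract f hf hJ r n).i.hom)
    ((ModuleCat.mono_iff_injective _).mp inferInstance)

end Retract

/-- A semilinear split injection exhibits a module as a retract of a restriction of scalars. -/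
def retractOfSemilinear {R R' M M' : Type} [CommRing R] [CommRing R'] (f : R →+* R')
    [AddCommGroup M] [Module R M] [AddCommGroup M'] [Module R' M'] (i : M →ₛₗ[f] M')
    (r : M' →+ M) (hr : ∀ q m, r (f q • m) = q • r m) (h : ∀ m, r (i m) = m) :
    Retract (ModuleCat.of R M) ((ModuleCat.restrictScalars f).obj (ModuleCat.of R' M')) where
  i := ModuleCat.ofHom (Y := (ModuleCat.restrictScalars f).obj (ModuleCat.of R' M'))
    { toFun := i
      map_add' := map_add i
      map_smul' := i.map_smulₛₗ }
  r := ModuleCat.ofHom (X := (ModuleCat.restrictScalars f).obj (ModuleCat.of R' M'))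
    { toFun := r
      map_add' := map_add r
      map_smul' := hr }
  retract := by
    ext m
    exact h m

section ContainsSupports

variable {k σ : Type} [Field k]

/-- An ideal containing, with every polynomial, all monomials in its support. -/
def ContainsSupports (K : Ideal (MvPolynomial σ k)) : Prop :=
  ∀ p ∈ K, ∀ c ∈ p.support, (monomial c 1 : MvPolynomial σ k) ∈ K

lemma mem_of_support_monomial_mem {K : Ideal (MvPolynomial σ k)} {p : MvPolynomial σ k}
    (h : ∀ c ∈ p.support, (monomial c 1 : MvPolynomial σ k) ∈ K) : p ∈ K := by
  rw [p.as_sum]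
  refine Ideal.sum_mem _ fun c hc => ?_
  have : (monomial c (coeff c p) : MvPolynomial σ k) = C (coeff c p) * monomial c 1 := by
    rw [C_mul_monomial, mul_one]
  rw [this]
  exact Ideal.mul_mem_left _ _ (h c hc)

lemma ContainsSupports.radical [Finite σ] {K : Ideal (MvPolynomial σ k)}
    (hK : ContainsSupports K) : ContainsSupports K.radical := by
  classical
  let _ : LinearOrder σ := IsWellOrder.linearOrder WellOrderingRel
  let m : MonomialOrder σ := MonomialOrder.lex
  intro p
  induction hn : p.support.card using Nat.strong_induction_on generalizing p with
  | _ n ih =>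
  intro hp c hc
  have hp0 : p ≠ 0 := by rintro rfl; simp at hc
  obtain ⟨l, hl⟩ := hp
  have hlead : (monomial (m.degree p) 1 : MvPolynomial σ k) ∈ K.radical := by
    refine ⟨l, ?_⟩
    rw [monomial_pow, one_pow]
    refine hK _ hl _ ?_
    rw [mem_support_iff, ← m.degree_pow]
    exact m.leadingCoeff_ne_zero_iff.mpr (pow_ne_zero _ hp0)
  by_cases hcd : c = m.degree p
  · rwa [hcd]
  let q := p - monomial (m.degree p) (coeff (m.degree p) p)
  have hq : q ∈ K.radical := by
    refine sub_mem ⟨l, hl⟩ ?_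
    have : (monomial (m.degree p) (coeff (m.degree p) p) : MvPolynomial σ k) =
      C (coeff (m.degree p) p) * monomial (m.degree p) 1 := by rw [C_mul_monomial, mul_one]
    rw [this]
    exact Ideal.mul_mem_left _ _ hlead
  have hsupp : q.support = p.support.erase (m.degree p) := by
    ext d
    simp only [q, mem_support_iff, Finset.mem_erase, coeff_sub, coeff_monomial]
    by_cases h : m.degree p = d
    · simp [h]
    · simp [h, Ne.symm h]
  refine ih q.support.card ?_ q rfl hq c ?_
  · rw [hsupp, ← hn]
    exact Finset.card_erase_lt_of_mem (mem_support_iff.mpr (m.leadingCoeff_ne_zero_iff.mpr hp0))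
  · rw [hsupp]
    exact Finset.mem_erase.mpr ⟨hcd, hc⟩

lemma containsSupports_span (T : Set (σ →₀ ℕ)) :
    ContainsSupports (Ideal.span ((fun d => monomial d (1 : k)) '' T)) := by
  intro p hp c hc
  rw [mem_ideal_span_monomial_image] at hp ⊢
  intro d hd
  rw [Finset.mem_singleton.mp (support_monomial_subset hd)]
  exact hp c hc

lemma ContainsSupports.colon {K : Ideal (MvPolynomial σ k)} (hK : ContainsSupports K)
    (a : σ →₀ ℕ) :
    ContainsSupports (Submodule.colon K (Ideal.span {(monomial a 1 : MvPolynomial σ k)})) := by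
  intro p hp c hc
  rw [Ideal.span, Submodule.colon_span, Submodule.mem_colon_singleton, smul_eq_mul] at hp ⊢
  rw [monomial_mul, one_mul]
  refine hK _ hp _ ?_
  rw [mem_support_iff, coeff_mul_monomial, mul_one]
  exact mem_support_iff.mp hc

/-- The exponents for which the embedding `p ↦ x ^ a * p (x ^ N)` below is well defined. -/
lemma exists_expand_exponent [Finite σ] (I : Ideal (MvPolynomial σ k)) (a : σ →₀ ℕ) :
    ∃ N : ℕ, 0 < N ∧ (∀ i, a i < N) ∧ ∀ q ∈ (Submodule.colon I
      (Ideal.span {(monomial a 1 : MvPolynomial σ k)})).radical, q ^ N * monomial a 1 ∈ I := by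
  obtain ⟨n, hn⟩ := Ideal.exists_radical_pow_le_of_fg
    (Submodule.colon I (Ideal.span {(monomial a 1 : MvPolynomial σ k)}))
    (IsNoetherian.noetherian _)
  refine ⟨n + a.degree + 1, by omega, fun i => ?_, fun q hq => ?_⟩
  · have := Finsupp.le_degree i a
    omega
  · have h : q ^ (n + a.degree + 1) ∈
        Submodule.colon I (Ideal.span {(monomial a 1 : MvPolynomial σ k)}) :=
      hn (Ideal.pow_le_pow_right (by omega) (Ideal.pow_mem_pow hq _))
    rw [Ideal.span, Submodule.colon_span, Submodule.mem_colon_singleton] at h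
    exact h

variable {I J : Ideal (MvPolynomial σ k)} {N : ℕ} {a : σ →₀ ℕ}

lemma expand_mul_monomial_mem (hJ : ContainsSupports J)
    (h : ∀ q ∈ J, q ^ N * monomial a 1 ∈ I) {p : MvPolynomial σ k} (hp : p ∈ J) :
    expand N p * monomial a 1 ∈ I := by
  rw [p.as_sum, map_sum, Finset.sum_mul]
  refine Ideal.sum_mem _ fun c hc => ?_
  have h1 := h _ (hJ p hp c hc)
  rw [monomial_pow, one_pow] at h1
  have : (monomial (N • c) (coeff c p) : MvPolynomial σ k) =
    C (coeff c p) * monomial (N • c) 1 := by rw [C_mul_monomial, mul_one]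
  rw [expand_monomial, this, mul_assoc]
  exact Ideal.mul_mem_left _ _ h1

lemma expandCoord_mem (hI : ContainsSupports I)
    (h : ∀ q, q ^ N * monomial a 1 ∈ I → q ∈ J)
    {p : MvPolynomial σ k} (hp : p ∈ I) : expandCoord N a p ∈ J := by
  classical
  rw [p.as_sum, map_sum]
  refine Ideal.sum_mem _ fun c hc => ?_
  rw [expandCoord_monomial]
  split_ifs with hca
  · have : (monomial (expDiv N c) (coeff c p) : MvPolynomial σ k) =
      C (coeff c p) * monomial (expDiv N c) 1 := by rw [C_mul_monomial, mul_one]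
    rw [this]
    refine Ideal.mul_mem_left _ _ (h _ ?_)
    rw [monomial_pow, one_pow, monomial_mul, one_mul, add_comm, ← hca, expRem_add_smul_expDiv]
    exact hI p hp c hc
  · exact zero_mem _

/-- `S ⧸ J` as a retract of `S ⧸ I` regarded as an `S`-module along `MvPolynomial.expand N`. -/
def quotientRetract (hN : 0 < N) (haN : expRem N a = a)
    (hι : ∀ p ∈ J, expand N p * monomial a 1 ∈ I) (hπ : ∀ p ∈ I, expandCoord N a p ∈ J) :
    Retract (ModuleCat.of (MvPolynomial σ k) (MvPolynomial σ k ⧸ J))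
      ((ModuleCat.restrictScalars
        (expand N : MvPolynomial σ k →ₐ[k] MvPolynomial σ k).toRingHom).obj
        (ModuleCat.of (MvPolynomial σ k) (MvPolynomial σ k ⧸ I))) :=
  retractOfSemilinear _
    (Submodule.liftQ J
      { toFun := fun p => Ideal.Quotient.mk I (expand N p * monomial a 1)
        map_add' := fun p q => by rw [map_add, add_mul, map_add]
        map_smul' := fun q p => (congrArg (Ideal.Quotient.mk I)
          (by rw [smul_eq_mul, map_mul (expand N), mul_assoc])).trans
            (map_mul (Ideal.Quotient.mk I) (expand N q) (expand N p * monomial a 1)) }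
      (fun p hp => Ideal.Quotient.eq_zero_iff_mem.mpr (hι p hp)))
    ((Submodule.liftQ (I.restrictScalars k) ((J.mkQ.restrictScalars k) ∘ₗ
        expandCoord N a) (fun p hp => Ideal.Quotient.eq_zero_iff_mem.mpr (hπ p hp))) ∘ₗ
          (Submodule.Quotient.restrictScalarsEquiv k I).symm.toLinearMap).toAddMonoidHom
    (fun q p => by
        obtain ⟨p, rfl⟩ := Ideal.Quotient.mk_surjective (I := I) p
        exact congrArg (Ideal.Quotient.mk J) (expandCoord_expand_mul N hN a q p))
    (fun p => by
        obtain ⟨p, rfl⟩ := Ideal.Quotient.mk_surjective p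
        exact congrArg (Ideal.Quotient.mk J) (expandCoord_expand_mul_monomial_self N hN haN p))

end ContainsSupports

section Unmixed

variable {R : Type} [CommRing R]

lemma ringKrullDim_quotient_le_of_le {I J : Ideal R} (h : I ≤ J) :
    ringKrullDim (R ⧸ J) ≤ ringKrullDim (R ⧸ I) :=
  ringKrullDim_le_of_surjective (Ideal.Quotient.factor h) (Ideal.Quotient.factor_surjective h)

lemma le_radical_colon (I : Ideal R) (u : R) :
    I ≤ (Submodule.colon I (Ideal.span {u})).radical := by
  refine le_trans (fun x hx => ?_) Ideal.le_radical
  rw [Ideal.span, Submodule.colon_span, Submodule.mem_colon_singleton]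
  exact Ideal.mul_mem_right _ _ hx

lemma mem_minimalPrimes_of_mem_associatedPrimes_quotient [IsNoetherianRing R] {J P : Ideal R}
    (hJ : J.IsRadical) (hP : P ∈ associatedPrimes R (R ⧸ J)) : P ∈ J.minimalPrimes := by
  obtain ⟨hPp, x, hx⟩ := isAssociatedPrime_iff.mp hP
  obtain ⟨y, rfl⟩ := Ideal.Quotient.mk_surjective x
  have hmem (s : R) : s ∈ P ↔ s * y ∈ J := by
    rw [hx, Submodule.mem_colon_singleton, Submodule.mem_bot, ← Ideal.Quotient.eq_zero_iff_mem,
      map_mul]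
    rfl
  have hy : y ∉ J := fun h => hPp.ne_top ((Ideal.eq_top_iff_one P).mpr ((hmem 1).mpr (by simpa)))
  rw [← hJ.radical, ← Ideal.sInf_minimalPrimes, Submodule.mem_sInf] at hy
  push Not at hy
  obtain ⟨Q, hQ, hyQ⟩ := hy
  have hPQ : P ≤ Q := fun s hs =>
    (hQ.1.1.mem_or_mem (hQ.1.2 ((hmem s).mp hs))).resolve_right hyQ
  have hJP : J ≤ P := fun s hs => (hmem s).mpr (Ideal.mul_mem_right _ _ hs)
  rwa [le_antisymm hPQ (hQ.2 ⟨hPp, hJP⟩ hPQ)]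

lemma associatedPrimes_quotient_radical_colon_subset [IsNoetherianRing R] (I : Ideal R) (u : R) :
    associatedPrimes R (R ⧸ (Submodule.colon I (Ideal.span {u})).radical) ⊆
      associatedPrimes R (R ⧸ I) := by
  intro P hP
  have h1 := mem_minimalPrimes_of_mem_associatedPrimes_quotient (Ideal.radical_isRadical _) hP
  rw [Ideal.radical_minimalPrimes] at h1
  have h2 : P ∈ associatedPrimes R (R ⧸ Submodule.colon I (Ideal.span {u})) := by
    refine Module.associatedPrimes.minimalPrimes_annihilator_subset_associatedPrimes R _ ?_
    rwa [Ideal.annihilator_quotient]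
  have hker : LinearMap.ker (I.mkQ ∘ₗ LinearMap.mulRight R u) =
      Submodule.colon I (Ideal.span {u}) := by
    ext s
    rw [Ideal.span, Submodule.colon_span, Submodule.mem_colon_singleton]
    exact Ideal.Quotient.eq_zero_iff_mem
  exact associatedPrimes.subset_of_injective
    (f := Submodule.liftQ _ (I.mkQ ∘ₗ LinearMap.mulRight R u) hker.ge)
    (LinearMap.ker_eq_bot.mp (Submodule.ker_liftQ_eq_bot _ _ _ hker.le)) h2

end Unmixed

lemma exists_retract_quotient_radical_colon {k σ : Type} [Field k] [Finite σ]
    (T : Set (σ →₀ ℕ)) (a : σ →₀ ℕ) {I : Ideal (MvPolynomial σ k)}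
    (hI : I = Ideal.span ((fun d => (monomial d (1 : k) : MvPolynomial σ k)) '' T)) :
    ∃ N : ℕ, 0 < N ∧ Nonempty (Retract (ModuleCat.of (MvPolynomial σ k)
        (MvPolynomial σ k ⧸ (Submodule.colon I
          (Ideal.span {(monomial a 1 : MvPolynomial σ k)})).radical))
      ((ModuleCat.restrictScalars
        (expand N : MvPolynomial σ k →ₐ[k] MvPolynomial σ k).toRingHom).obj
        (ModuleCat.of (MvPolynomial σ k) (MvPolynomial σ k ⧸ I)))) := by
  obtain ⟨N, hN, haN, hq⟩ := exists_expand_exponent I a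
  have hIs : ContainsSupports I := hI ▸ containsSupports_span T
  refine ⟨N, hN, ⟨quotientRetract hN (Finsupp.ext fun i => Nat.mod_eq_of_lt (haN i))
    (fun p => expand_mul_monomial_mem (hIs.colon a).radical hq)
    (fun p => expandCoord_mem hIs fun q h => Ideal.mem_radical_iff.mpr ⟨N, ?_⟩)⟩⟩
  rw [Ideal.span, Submodule.colon_span, Submodule.mem_colon_singleton]
  exact h

/-- Let `I` be a monomial ideal and `P` one of the properties
Cohen-Macaulay, generalized Cohen-Macaulay, unmixed. If `I` has property `P` then so does
every associated radical `√(I : u)` of `I` (`u` a monomial not in `I`). -/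
theorem stmt_12 (k σ : Type) [Field k] [Fintype σ] (I : Ideal (MvPolynomial σ k))
    (hI : IsMonomialIdeal I) (u : MvPolynomial σ k) (hu : IsMonomial u) (huI : u ∉ I) :
    (IsCMIdeal (maxIdeal k σ) I →
      IsCMIdeal (maxIdeal k σ) (Submodule.colon I (Ideal.span {u})).radical) ∧
    (IsGCMIdeal (maxIdeal k σ) I →
      IsGCMIdeal (maxIdeal k σ) (Submodule.colon I (Ideal.span {u})).radical) ∧
    (IsUnmixedIdeal I →
      IsUnmixedIdeal (Submodule.colon I (Ideal.span {u})).radical) := by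
  obtain ⟨T, hT⟩ := hI
  obtain ⟨a, rfl⟩ := hu
  obtain ⟨N, hN, ⟨r⟩⟩ := exists_retract_quotient_radical_colon T a hT
  have : NeZero N := ⟨hN.ne'⟩
  have hle := ringKrullDim_quotient_le_of_le (le_radical_colon I (monomial a (1 : k)))
  obtain ⟨hflat, hfin⟩ := expand_flat_finite k σ N
  have hrad := radical_map_expand_maxIdeal k σ N
  refine ⟨fun h i hi => ?_, fun h i hi => ?_, fun h P hP => ?_⟩
  · exact isZero_localCohomology_of_retract _ hflat hrad r i (h i (hi.trans_le hle))
  · exact isFiniteLength_localCohomology_of_retract _ hflat hrad r i hfin (h i (hi.trans_le hle))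
  · refine le_antisymm (ringKrullDim_quotient_le_of_le ?_) (hle.trans (h P ?_).ge)
    · exact (mem_minimalPrimes_of_mem_associatedPrimes_quotient
        (Ideal.radical_isRadical _) hP).1.2
    · exact associatedPrimes_quotient_radical_colon_subset _ _ hP

end SkewTab
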